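/- arXiv:2310.13905 — 3 statements merged into one kernel-verified Lean document; each statement's English description precedes it below -/
import Mathlib

section
/- Discrete Gagliardo–Nirenberg–Sobolev inequality: let n ≥ 2, p > 1, γ ≥ p and p' = p/(p−1). Then there exists a constant C(p,n,γ) > 0 such that for every u ∈ l^p(ℤⁿ), ‖u‖_{l^{γn/(n−1)}(ℤⁿ)}^γ ≤ C(p,n,γ) · ‖u‖_{D^{1,p}(ℤⁿ)} · ‖u‖_{l^{(γ−1)p'}(ℤⁿ)}^{γ−1}. -/
open Real

/-- Vertices of the lattice graph `ℤⁿ`. -/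
abbrev Zn (n : ℕ) : Type := Fin n → ℤ

/-- The `i`-th standard basis vector. -/
def ee {n : ℕ} (i : Fin n) : Zn n := fun j => if j = i then 1 else 0

/-- `d(x) = d(x,0) = ∑ |xᵢ|`. -/
def dd {n : ℕ} (x : Zn n) : ℕ := ∑ i, (x i).natAbs

/-- The set of neighbors of `x`, i.e. `{y : d(x,y) = 1}`. -/
def nbrs {n : ℕ} (x : Zn n) : Finset (Zn n) :=
  (Finset.image (fun i : Fin n => x + ee i) Finset.univ) ∪
  (Finset.image (fun i : Fin n => x - ee i) Finset.univ)

/-- The graph Laplacian `Δu(x) = ∑_{y ~ x} (u(y) - u(x))`. -/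
def lap {n : ℕ} (u : Zn n → ℝ) (x : Zn n) : ℝ := ∑ y ∈ nbrs x, (u y - u x)

/-- The vertex boundary `δΩ` of a finite set `Ω ⊂ ℤⁿ`. -/
def bdry {n : ℕ} (Ω : Finset (Zn n)) : Finset (Zn n) := Ω.biUnion nbrs \ Ω

/-- `Ω̄ = Ω ∪ δΩ`. -/
def clos {n : ℕ} (Ω : Finset (Zn n)) : Finset (Zn n) := Ω ∪ bdry Ω

/-- The `l^q` norm `(∑_x |u(x)|^q)^{1/q}`, valued in `ℝ≥0∞`. -/
noncomputable def lqN {n : ℕ} (q : ℝ) (u : Zn n → ℝ) : ENNReal :=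
  (∑' x : Zn n, ENNReal.ofReal (|u x| ^ q)) ^ (1 / q)

/-- The `D^{1,p}` seminorm `(∑_x ∑_{y~x} |u(y)-u(x)|^p)^{1/p}`, valued in `ℝ≥0∞`. -/
noncomputable def d1pN {n : ℕ} (p : ℝ) (u : Zn n → ℝ) : ENNReal :=
  (∑' x : Zn n, ENNReal.ofReal (∑ y ∈ nbrs x, |u y - u x| ^ p)) ^ (1 / p)

open Filter Topology MeasureTheory

theorem ofReal_abs_le_tsum_forward_diff {g : ℤ → ℝ} (hg : Tendsto g cofinite (𝓝 0)) (t : ℤ) :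
    ENNReal.ofReal |g t| ≤ ∑' s : ℤ, ENNReal.ofReal |g (s + 1) - g s| := by
  have hinj : Function.Injective fun N : ℕ => t + (N : ℤ) := fun a b h => by simpa using h
  have hlim : Tendsto (fun N : ℕ => ENNReal.ofReal |g (t + N)| +
      ∑' s : ℤ, ENNReal.ofReal |g (s + 1) - g s|) atTop
      (𝓝 (ENNReal.ofReal |(0 : ℝ)| + ∑' s : ℤ, ENNReal.ofReal |g (s + 1) - g s|)) := by
    refine Tendsto.add_const _ ((ENNReal.continuous_ofReal.tendsto _).comp ?_)
    rw [← Nat.cofinite_eq_atTop]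
    exact (hg.comp hinj.tendsto_cofinite).abs
  have key : ∀ N : ℕ, ENNReal.ofReal |g t| ≤ ENNReal.ofReal |g (t + N)| +
      ∑' s : ℤ, ENNReal.ofReal |g (s + 1) - g s| := by
    intro N
    have htel : |g t| ≤ |g (t + N)| +
        ∑ k ∈ Finset.range N, |g (t + (k : ℕ) + 1) - g (t + (k : ℕ))| := by
      induction N with
      | zero => simp
      | succ k ih =>
        rw [Finset.sum_range_succ]
        have h := abs_sub_abs_le_abs_sub (g (t + k)) (g (t + k + 1))
        rw [abs_sub_comm] at h
        push_cast
        rw [← add_assoc, ← add_assoc]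
        linarith
    refine (ENNReal.ofReal_le_ofReal htel).trans ?_
    rw [ENNReal.ofReal_add (abs_nonneg _) (Finset.sum_nonneg fun _ _ => abs_nonneg _),
      ENNReal.ofReal_sum_of_nonneg fun _ _ => abs_nonneg _]
    gcongr
    exact (ENNReal.sum_le_tsum _).trans
      (ENNReal.tsum_comp_le_tsum_of_injective hinj
        fun s : ℤ => ENNReal.ofReal |g (s + 1) - g s|)
  simpa using ge_of_tendsto' hlim key

theorem abs_rpow_sub_rpow_le {a b γ : ℝ} (ha : 0 ≤ a) (hb : 0 ≤ b) (hγ : 1 ≤ γ) :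
    |a ^ γ - b ^ γ| ≤ γ * (|a - b| * (a ^ (γ - 1) + b ^ (γ - 1))) := by
  wlog hab : b ≤ a generalizing a b
  · have := this hb ha (le_of_not_ge hab)
    rwa [abs_sub_comm, abs_sub_comm b a, add_comm] at this
  rcases ha.eq_or_lt with rfl | ha'
  · obtain rfl : b = 0 := le_antisymm hab hb
    simp
  have hpow : b ^ γ ≤ a ^ γ := Real.rpow_le_rpow hb hab (by linarith)
  rw [abs_of_nonneg (sub_nonneg.2 hpow), abs_of_nonneg (sub_nonneg.2 hab)]
  have hbern := one_add_mul_self_le_rpow_one_add (s := b / a - 1)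
    (by linarith [div_nonneg hb ha]) hγ
  rw [add_sub_cancel, Real.div_rpow hb ha, le_div_iff₀ (by positivity)] at hbern
  have hsplit : a ^ γ = a ^ (γ - 1) * a := by
    rw [← Real.rpow_add_one ha'.ne', sub_add_cancel]
  have heq : (1 + γ * (b / a - 1)) * a ^ γ = a ^ γ - γ * ((a - b) * a ^ (γ - 1)) := by
    rw [hsplit]
    field_simp
    ring
  have hnn : 0 ≤ γ * ((a - b) * b ^ (γ - 1)) :=
    mul_nonneg (by linarith) (mul_nonneg (sub_nonneg.2 hab) (by positivity))
  linarith

theorem tsum_mul_le_rpow_tsum_mul_rpow_tsum {α : Type*} {p q : ℝ} (hpq : p.HolderConjugate q)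
    (f g : α → ENNReal) :
    ∑' x, f x * g x ≤ (∑' x, f x ^ p) ^ (1 / p) * (∑' x, g x ^ q) ^ (1 / q) := by
  let : MeasurableSpace α := ⊤
  have : DiscreteMeasurableSpace α := ⟨fun _ => trivial⟩
  simpa [lintegral_count] using ENNReal.lintegral_mul_le_Lp_mul_Lq (μ := Measure.count) hpq
    (f := f) (g := g) (by fun_prop) (by fun_prop)

theorem Measure.pi_count_eq_count {ι : Type*} [Fintype ι] {A : ι → Type*}
    [∀ i, MeasurableSpace (A i)] [∀ i, Countable (A i)] [∀ i, MeasurableSingletonClass (A i)] :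
    Measure.pi (fun i => (Measure.count : Measure (A i))) = Measure.count := by
  refine Measure.ext_of_singleton fun x => ?_
  simp [Measure.pi_singleton]

theorem tsum_prod_tsum_update_rpow_le {ι : Type*} [Fintype ι] [DecidableEq ι] {p : ℝ}
    (hp : Real.HolderConjugate (Fintype.card ι) p) (f : (ι → ℤ) → ENNReal) :
    ∑' x : ι → ℤ, ∏ i, (∑' t : ℤ, f (Function.update x i t)) ^
      ((1 : ℝ) / ((Fintype.card ι : ℝ) - 1)) ≤ (∑' x, f x) ^ p := by
  have h := lintegral_prod_lintegral_pow_le (A := fun _ : ι => ℤ)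
    (fun _ => (Measure.count : Measure ℤ)) hp (f := f) (measurable_of_countable f)
  simpa only [Measure.pi_count_eq_count, lintegral_count] using h

theorem tsum_rpow_le_rpow_tsum_forward_diff {n : ℕ} (hn : 2 ≤ n) {w : Zn n → ℝ}
    (hw : Tendsto w cofinite (𝓝 0)) :
    ∑' x, ENNReal.ofReal |w x| ^ ((n : ℝ) / (n - 1)) ≤
      (∑' x, ∑ i, ENNReal.ofReal |w (x + ee i) - w x|) ^ ((n : ℝ) / (n - 1)) := by
  have hn' : (2 : ℝ) ≤ n := by exact_mod_cast hn
  have hconj : Real.HolderConjugate (Fintype.card (Fin n)) ((n : ℝ) / (n - 1)) := by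
    rw [Fintype.card_fin]
    exact Real.HolderConjugate.conjExponent (by linarith)
  refine le_trans (ENNReal.tsum_le_tsum fun x => ?_) (tsum_prod_tsum_update_rpow_le hconj _)
  have hline : ∀ i, ENNReal.ofReal |w x| ≤ ∑' t : ℤ,
      ∑ j, ENNReal.ofReal |w (Function.update x i t + ee j) - w (Function.update x i t)| := by
    intro i
    have h := ofReal_abs_le_tsum_forward_diff
      (hw.comp (Function.update_injective x i).tendsto_cofinite) (x i)
    simp only [Function.comp_apply, Function.update_eq_self] at h
    refine h.trans (ENNReal.tsum_le_tsum fun t => ?_)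
    have hstep : Function.update x i (t + 1) = Function.update x i t + ee i := by
      ext j
      by_cases hj : j = i
      · subst hj; simp [ee]
      · simp [ee, hj]
    rw [hstep]
    exact Finset.single_le_sum
      (f := fun j => ENNReal.ofReal |w (Function.update x i t + ee j) - w (Function.update x i t)|)
      (fun _ _ => zero_le) (Finset.mem_univ i)
  calc ENNReal.ofReal |w x| ^ ((n : ℝ) / (n - 1))
      = ∏ _i : Fin n, ENNReal.ofReal |w x| ^ ((1 : ℝ) / ((Fintype.card (Fin n) : ℝ) - 1)) := by
        rw [Finset.prod_const, Finset.card_univ, Fintype.card_fin, ← ENNReal.rpow_natCast,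
          ← ENNReal.rpow_mul]
        congr 1
        ring
    _ ≤ _ := by
        refine Finset.prod_le_prod' fun i _ => ENNReal.rpow_le_rpow (hline i) ?_
        rw [Fintype.card_fin]
        exact div_nonneg zero_le_one (by linarith)

theorem tsum_mul_le_d1pN_mul_lqN {n : ℕ} {p q s : ℝ} (hpq : p.HolderConjugate q) (hs : 0 < s)
    (u : Zn n → ℝ) (i : Fin n) (e : Zn n ≃ Zn n) :
    ∑' x, ENNReal.ofReal |u (x + ee i) - u x| * ENNReal.ofReal (|u (e x)| ^ s) ≤
      d1pN p u * lqN (s * q) u ^ s := by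
  have hp := hpq.pos
  have hq := hpq.symm.pos
  refine (tsum_mul_le_rpow_tsum_mul_rpow_tsum hpq _ _).trans (mul_le_mul' ?_ ?_)
  · refine ENNReal.rpow_le_rpow (ENNReal.tsum_le_tsum fun x => ?_) (by positivity)
    rw [ENNReal.ofReal_rpow_of_nonneg (abs_nonneg _) hp.le]
    refine ENNReal.ofReal_le_ofReal (Finset.single_le_sum (f := fun y => |u y - u x| ^ p)
      (fun _ _ => by positivity) ?_)
    simp [nbrs]
  · rw [lqN, ← ENNReal.rpow_mul, e.tsum_eq fun x => ENNReal.ofReal (|u x| ^ s) ^ q]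
    refine le_of_eq ?_
    congr 1
    · refine tsum_congr fun x => ?_
      rw [ENNReal.ofReal_rpow_of_nonneg (by positivity) hq.le, ← Real.rpow_mul (abs_nonneg _)]
    · field_simp

theorem tsum_forward_diff_rpow_le {n : ℕ} {p q γ : ℝ} (hpq : p.HolderConjugate q) (hγ : 1 < γ)
    (u : Zn n → ℝ) :
    ∑' x, ∑ i, ENNReal.ofReal |(|u (x + ee i)| ^ γ) - |u x| ^ γ| ≤
      ENNReal.ofReal (2 * n * γ) * d1pN p u * lqN ((γ - 1) * q) u ^ (γ - 1) := by
  set B := d1pN p u * lqN ((γ - 1) * q) u ^ (γ - 1) with hB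
  have hγ0 : 0 ≤ γ := by linarith
  have hdir : ∀ i : Fin n, ∑' x, ENNReal.ofReal |(|u (x + ee i)| ^ γ) - |u x| ^ γ| ≤
      ENNReal.ofReal γ * (B + B) := by
    intro i
    calc ∑' x, ENNReal.ofReal |(|u (x + ee i)| ^ γ) - |u x| ^ γ|
        ≤ ∑' x, ENNReal.ofReal γ *
            (ENNReal.ofReal |u (x + ee i) - u x| * ENNReal.ofReal (|u (x + ee i)| ^ (γ - 1)) +
            ENNReal.ofReal |u (x + ee i) - u x| * ENNReal.ofReal (|u x| ^ (γ - 1))) := by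
          refine ENNReal.tsum_le_tsum fun x => ?_
          rw [← mul_add, ← ENNReal.ofReal_add (by positivity) (by positivity),
            ← ENNReal.ofReal_mul (abs_nonneg _), ← ENNReal.ofReal_mul hγ0]
          refine ENNReal.ofReal_le_ofReal
            ((abs_rpow_sub_rpow_le (abs_nonneg _) (abs_nonneg _) hγ.le).trans ?_)
          gcongr γ * (?_ * _)
          exact abs_abs_sub_abs_le _ _
      _ ≤ ENNReal.ofReal γ * (B + B) := by
          rw [ENNReal.tsum_mul_left, ENNReal.tsum_add]
          gcongr
          · exact tsum_mul_le_d1pN_mul_lqN hpq (by linarith) u i (Equiv.addRight (ee i))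
          · exact tsum_mul_le_d1pN_mul_lqN hpq (by linarith) u i (Equiv.refl _)
  rw [Summable.tsum_finsetSum fun _ _ => ENNReal.summable]
  refine (Finset.sum_le_sum fun i _ => hdir i).trans_eq ?_
  rw [Finset.sum_const, Finset.card_univ, Fintype.card_fin, nsmul_eq_mul, mul_assoc, ← hB,
    ENNReal.ofReal_mul (by positivity), ENNReal.ofReal_mul (by positivity), ENNReal.ofReal_natCast,
    ENNReal.ofReal_ofNat]
  ring

theorem tendsto_abs_rpow_cofinite_of_summable {α : Type*} {p γ : ℝ} (hp : 0 < p) (hγ : 0 < γ)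
    {u : α → ℝ} (hu : Summable fun x => |u x| ^ p) :
    Tendsto (fun x => |u x| ^ γ) cofinite (𝓝 0) := by
  have h := hu.tendsto_cofinite_zero.rpow_const (p := γ / p) (Or.inr (by positivity))
  rw [Real.zero_rpow (by positivity)] at h
  refine h.congr fun x => ?_
  rw [← Real.rpow_mul (abs_nonneg _), mul_div_cancel₀ _ hp.ne']

/-- The discrete Gagliardo–Nirenberg–Sobolev inequality on `ℤⁿ`. -/
theorem stmt7 (n : ℕ) (hn : 2 ≤ n) (p γ : ℝ) (hp : 1 < p) (hγ : p ≤ γ) :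
    ∃ C : ℝ, 0 < C ∧ ∀ u : Zn n → ℝ, Summable (fun x : Zn n => |u x| ^ p) →
      lqN (γ * n / ((n : ℝ) - 1)) u ^ γ
        ≤ ENNReal.ofReal C * d1pN p u * lqN ((γ - 1) * (p / (p - 1))) u ^ (γ - 1) := by
  have hn' : (2 : ℝ) ≤ n := by exact_mod_cast hn
  have hn1 : 0 < (n : ℝ) - 1 := by linarith
  have hγ0 : 0 < γ := by linarith
  refine ⟨2 * n * γ, by positivity, fun u hu => ?_⟩
  refine le_trans ?_
    (tsum_forward_diff_rpow_le (Real.HolderConjugate.conjExponent hp) (hp.trans_le hγ) u)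
  have hsob := tsum_rpow_le_rpow_tsum_forward_diff hn
    (tendsto_abs_rpow_cofinite_of_summable (by linarith) hγ0 hu)
  have hexp : lqN (γ * n / ((n : ℝ) - 1)) u ^ γ =
      (∑' x, ENNReal.ofReal |(|u x| ^ γ)| ^ ((n : ℝ) / (n - 1))) ^ ((n : ℝ) / (n - 1))⁻¹ := by
    rw [lqN, ← ENNReal.rpow_mul]
    congr 1
    · refine tsum_congr fun x => ?_
      rw [ENNReal.ofReal_rpow_of_nonneg (abs_nonneg _) (by positivity),
        abs_of_nonneg (by positivity : 0 ≤ |u x| ^ γ), ← Real.rpow_mul (abs_nonneg _),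
        mul_div_assoc]
    · field_simp
  rw [hexp]
  refine (ENNReal.rpow_le_rpow hsob (by positivity)).trans_eq ?_
  rw [← ENNReal.rpow_mul, mul_inv_cancel₀ (by positivity), ENNReal.rpow_one]
end

section
/- Existence for the Dirichlet problem on a finite connected subset: the iteration sequence (u_k) converges pointwise on Ω̄ to a function u_Ω : Ω̄ → ℝ satisfying Δu_Ω(x) = λ e^{u_Ω(x)}(e^{u_Ω(x)} − 1) + g(x) for all x ∈ Ω and u_Ω = 0 on δΩ. In particular the Dirichlet problem Δu = λ e^u(e^u − 1) + g on Ω, u = 0 on δΩ, has a solution. -/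
open Real

/-- `Ω` is connected in the graph sense. -/
def connFinset {n : ℕ} (Ω : Finset (Zn n)) : Prop :=
  ∀ x ∈ Ω, ∀ y ∈ Ω, ∃ (m : ℕ) (c : ℕ → Zn n),
    c 0 = x ∧ c m = y ∧ (∀ i ≤ m, c i ∈ Ω) ∧ ∀ i < m, c (i + 1) ∈ nbrs (c i)

theorem ee_self {n : ℕ} (i : Fin n) : ee i i = 1 := by simp [ee]

theorem ee_injective {n : ℕ} : Function.Injective (ee : Fin n → Zn n) := by
  intro i j h
  by_contra hne
  have := congrFun h i
  simp [ee, hne] at this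

theorem ee_nonneg {n : ℕ} (i j : Fin n) : 0 ≤ ee i j := by
  unfold ee
  split_ifs <;> simp

theorem lap_eq_sum {n : ℕ} (u : Zn n → ℝ) (x : Zn n) :
    lap u x = ∑ i, ((u (x + ee i) - u x) + (u (x - ee i) - u x)) := by
  unfold lap nbrs
  rw [Finset.sum_union, Finset.sum_image, Finset.sum_image, Finset.sum_add_distrib]
  · intro i _ j _ h
    exact ee_injective (sub_right_injective h)
  · intro i _ j _ h
    exact ee_injective (add_right_injective x h)
  · rw [Finset.disjoint_left]
    intro y hy hy'
    simp only [Finset.mem_image, Finset.mem_univ, true_and] at hy hy'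
    obtain ⟨i, rfl⟩ := hy
    obtain ⟨j, hj⟩ := hy'
    have h := congrFun hj i
    simp only [Pi.sub_apply, Pi.add_apply, ee_self] at h
    have := ee_nonneg j i
    omega

theorem lap_sub {n : ℕ} (u v : Zn n → ℝ) (x : Zn n) :
    lap (fun y => u y - v y) x = lap u x - lap v x := by
  unfold lap
  rw [← Finset.sum_sub_distrib]
  exact Finset.sum_congr rfl fun y _ => by ring

theorem lap_sq_coord {n : ℕ} (i : Fin n) (c d : ℝ) (x : Zn n) :
    lap (fun y => c * ((y i : ℝ) ^ 2 - d)) x = 2 * c := by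
  rw [lap_eq_sum, Finset.sum_eq_single i]
  · simp only [Pi.add_apply, Pi.sub_apply, ee_self]
    push_cast
    ring
  · intro j _ hj
    simp [ee, hj.symm]
  · simp

theorem mem_clos_of_mem_nbrs {n : ℕ} {Ω : Finset (Zn n)} {x y : Zn n} (hx : x ∈ Ω)
    (hy : y ∈ nbrs x) : y ∈ clos Ω := by
  by_cases h : y ∈ Ω
  · exact Finset.mem_union_left _ h
  · exact Finset.mem_union_right _
      (Finset.mem_sdiff.2 ⟨Finset.mem_biUnion.2 ⟨x, hx, hy⟩, h⟩)

/-- The maximum principle for `Δ - K` with `K > 0`. -/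
theorem nonpos_of_lap_sub_mul_nonneg {n : ℕ} {Ω : Finset (Zn n)} {K : ℝ} (hK : 0 < K)
    {v : Zn n → ℝ} (hv : ∀ x ∈ Ω, 0 ≤ lap v x - K * v x) (hb : ∀ x ∈ bdry Ω, v x ≤ 0) :
    ∀ x ∈ clos Ω, v x ≤ 0 := by
  intro x hx
  obtain ⟨z, hz, hmax⟩ := Finset.exists_max_image (clos Ω) v ⟨x, hx⟩
  refine (hmax x hx).trans ?_
  rcases Finset.mem_union.1 hz with hzΩ | hzb
  · have hlap : lap v z ≤ 0 := Finset.sum_nonpos fun y hy =>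
      sub_nonpos.2 (hmax y (mem_clos_of_mem_nbrs hzΩ hy))
    have h := hv z hzΩ
    by_contra! hpos
    have := mul_pos hK hpos
    linarith
  · exact hb z hzb

theorem mul_exp_mul_exp_sub_one_sub_mul_le {lam K s t : ℝ} (hlam : 0 < lam) (hK : lam ≤ K)
    (hst : s ≤ t) (ht : t ≤ 0) :
    lam * (Real.exp t * (Real.exp t - 1)) - K * t
      ≤ lam * (Real.exp s * (Real.exp s - 1)) - K * s := by
  have ha1 : Real.exp t ≤ 1 := Real.exp_le_one_iff.2 ht
  have hba : Real.exp s ≤ Real.exp t := Real.exp_le_exp.2 hst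
  have ha0 := Real.exp_pos t
  have hdiff : Real.exp t - Real.exp s ≤ t - s := by
    have h1 : Real.exp s = Real.exp t * Real.exp (s - t) := by
      rw [← Real.exp_add]
      ring_nf
    have h2 := Real.add_one_le_exp (s - t)
    nlinarith
  have h3 : Real.exp t * (Real.exp t - 1) - Real.exp s * (Real.exp s - 1) ≤ t - s := by
    nlinarith
  have h4 := mul_le_mul_of_nonneg_left h3 hlam.le
  have h5 := mul_le_mul_of_nonneg_right hK (sub_nonneg.2 hst)
  linarith

/-- Any bounded-above right-hand side admits a nonpositive subsolution of the Poisson equation. -/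
theorem exists_nonpos_le_lap {n : ℕ} (hn : 0 < n) (S Ω : Finset (Zn n)) (g : Zn n → ℝ) :
    ∃ w : Zn n → ℝ, (∀ x ∈ S, w x ≤ 0) ∧ ∀ x ∈ Ω, g x ≤ lap w x := by
  obtain ⟨C, hC⟩ := (Ω.image g).bddAbove
  obtain ⟨R, hR⟩ := (S.image fun x => ((x ⟨0, hn⟩ : ℤ) : ℝ) ^ 2).bddAbove
  refine ⟨fun y => |C| * ((y ⟨0, hn⟩ : ℝ) ^ 2 - R), fun x hx => ?_, fun x hx => ?_⟩
  · exact mul_nonpos_of_nonneg_of_nonpos (abs_nonneg C)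
      (sub_nonpos.2 (hR (Finset.mem_coe.2 (Finset.mem_image_of_mem _ hx))))
  · rw [lap_sq_coord]
    have h1 : g x ≤ C := hC (Finset.mem_coe.2 (Finset.mem_image_of_mem _ hx))
    have h2 := le_abs_self C
    have h3 := abs_nonneg C
    linarith

/-- The iteration sequence converges to a solution of the Dirichlet problem
`Δu = λe^u(e^u-1) + g` on `Ω`, `u = 0` on `δΩ`. -/
theorem stmt10 (n : ℕ) (hn : 2 ≤ n) (lam : ℝ) (hlam : 0 < lam)
    (M : ℕ) (hM : 1 ≤ M) (nn : Fin M → ℕ) (hnn : ∀ j, 0 < nn j)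
    (p : Fin M → Zn n) (hp : Function.Injective p)
    (g : Zn n → ℝ)
    (hg : ∀ x, g x = ∑ j, if x = p j then 4 * Real.pi * (nn j : ℝ) else 0)
    (K : ℝ) (hK : 2 * lam < K)
    (Ω : Finset (Zn n)) (hΩp : ∀ j, p j ∈ Ω) (hconn : connFinset Ω)
    (U : ℕ → Zn n → ℝ)
    (hU0 : ∀ x ∈ clos Ω, U 0 x = 0)
    (hUeq : ∀ k : ℕ, ∀ x ∈ Ω,
      lap (U (k + 1)) x - K * U (k + 1) x
        = lam * (Real.exp (U k x) * (Real.exp (U k x) - 1)) + g x - K * U k x)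
    (hUbd : ∀ k : ℕ, ∀ x ∈ bdry Ω, U (k + 1) x = 0) :
    ∃ w : Zn n → ℝ,
      (∀ x ∈ clos Ω,
        Filter.Tendsto (fun k => U k x) Filter.atTop (nhds (w x))) ∧
      (∀ x ∈ Ω, lap w x = lam * (Real.exp (w x) * (Real.exp (w x) - 1)) + g x) ∧
      (∀ x ∈ bdry Ω, w x = 0) := by
  have hKpos : 0 < K := by linarith
  have hKlam : lam ≤ K := by linarith
  have hΩ_clos : ∀ x ∈ Ω, x ∈ clos Ω := fun x hx => Finset.mem_union_left _ hx
  have hb_clos : ∀ x ∈ bdry Ω, x ∈ clos Ω := fun x hx => Finset.mem_union_right _ hx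
  have hUb : ∀ k, ∀ x ∈ bdry Ω, U k x = 0 := by
    rintro (_ | k) x hx
    · exact hU0 x (hb_clos x hx)
    · exact hUbd k x hx
  have hg0 : ∀ x, 0 ≤ g x := by
    intro x
    rw [hg]
    refine Finset.sum_nonneg fun j _ => ?_
    split_ifs <;> positivity
  have hmono : ∀ k, ∀ x ∈ clos Ω, U (k + 1) x ≤ U k x ∧ U k x ≤ 0 := by
    intro k
    induction k with
    | zero =>
      intro x hx
      refine ⟨?_, (hU0 x hx).le⟩
      rw [hU0 x hx]
      refine nonpos_of_lap_sub_mul_nonneg hKpos (fun y hy => ?_)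
        (fun y hy => (hUb _ y hy).le) x hx
      rw [hUeq 0 y hy, hU0 y (hΩ_clos y hy)]
      simpa using hg0 y
    | succ k ih =>
      intro x hx
      refine ⟨sub_nonpos.1 (nonpos_of_lap_sub_mul_nonneg (Ω := Ω)
        (v := fun y => U (k + 1 + 1) y - U (k + 1) y) hKpos (fun y hy => ?_)
        (fun y hy => ?_) x hx), (ih x hx).1.trans (ih x hx).2⟩
      · rw [lap_sub]
        have h1 := hUeq (k + 1) y hy
        have h2 := hUeq k y hy
        obtain ⟨h3, h4⟩ := ih y (hΩ_clos y hy)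
        have h5 := mul_exp_mul_exp_sub_one_sub_mul_le hlam hKlam h3 h4
        linarith
      · simp [hUb _ y hy]
  obtain ⟨b, hb0, hbg⟩ := exists_nonpos_le_lap (by omega : 0 < n) (clos Ω) Ω g
  have hlower : ∀ k, ∀ x ∈ clos Ω, b x ≤ U k x := by
    intro k
    induction k with
    | zero =>
      intro x hx
      rw [hU0 x hx]
      exact hb0 x hx
    | succ k ih =>
      intro x hx
      refine sub_nonpos.1 (nonpos_of_lap_sub_mul_nonneg (Ω := Ω)
        (v := fun y => b y - U (k + 1) y) hKpos (fun y hy => ?_) (fun y hy => ?_) x hx)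
      · rw [lap_sub]
        have hy' := hΩ_clos y hy
        have h1 := hUeq k y hy
        have h2 := hbg y hy
        have h3 := mul_exp_mul_exp_sub_one_sub_mul_le hlam hKlam (ih y hy') (hmono k y hy').2
        have h4 : lam * (Real.exp (b y) * (Real.exp (b y) - 1)) ≤ 0 :=
          mul_nonpos_of_nonneg_of_nonpos hlam.le (mul_nonpos_of_nonneg_of_nonpos
            (Real.exp_pos _).le (sub_nonpos.2 (Real.exp_le_one_iff.2 (hb0 y hy'))))
        linarith
      · simpa [hUb _ y hy] using hb0 y (hb_clos y hy)
  have hlim : ∀ x ∈ clos Ω,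
      Filter.Tendsto (fun k => U k x) Filter.atTop (nhds (⨅ k, U k x)) := fun x hx =>
    tendsto_atTop_ciInf (antitone_nat_of_succ_le fun k => (hmono k x hx).1)
      ⟨b x, by rintro _ ⟨k, rfl⟩; exact hlower k x hx⟩
  refine ⟨fun x => ⨅ k, U k x, hlim, fun x hx => ?_, fun x hx => ?_⟩
  · have hx' := hlim x (hΩ_clos x hx)
    have hlap : Filter.Tendsto (fun k => lap (U k) x) Filter.atTop
        (nhds (lap (fun y => ⨅ k, U k y) x)) :=
      tendsto_finsetSum _ fun y hy => (hlim y (mem_clos_of_mem_nbrs hx hy)).sub hx'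
    have hleft := (hlap.comp (Filter.tendsto_add_atTop_nat 1)).sub
      ((hx'.comp (Filter.tendsto_add_atTop_nat 1)).const_mul K)
    have hexp := (Real.continuous_exp.tendsto _).comp hx'
    have hright := (((hexp.mul (hexp.sub_const 1)).const_mul lam).add_const (g x)).sub
      (hx'.const_mul K)
    have := tendsto_nhds_unique (hleft.congr fun k => hUeq k x hx) hright
    linarith
  · simp [hUb _ x hx]
end

section
/- Uniform l² bound for Dirichlet solutions: there exists a constant C₀ > 0, depending only on n, λ and ∑_{j=1}^M n_j, such that for every finite subset Ω ⊂ ℤⁿ with p₁,…,p_M ∈ Ω, the boundary value problem Δw = λ e^w(e^w − 1) + g on Ω, w = 0 on δΩ, has a solution w : Ω̄ → ℝ with (∑_{x∈Ω} w(x)²)^{1/2} ≤ C₀, and this solution is maximal: every v : Ω̄ → ℝ with Δv = λ e^v(e^v − 1) + g on Ω and v ≤ 0 on δΩ satisfies v ≤ w on Ω̄. -/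
open Real

theorem mem_nbrs {n : ℕ} {x y : Zn n} :
    y ∈ nbrs x ↔ ∃ i, y = x + ee i ∨ y = x - ee i := by
  simp only [nbrs, Finset.mem_union, Finset.mem_image, Finset.mem_univ, true_and]
  constructor
  · rintro (⟨i, h⟩ | ⟨i, h⟩)
    · exact ⟨i, Or.inl h.symm⟩
    · exact ⟨i, Or.inr h.symm⟩
  · rintro ⟨i, h | h⟩
    · exact Or.inl ⟨i, h.symm⟩
    · exact Or.inr ⟨i, h.symm⟩

theorem mem_nbrs_comm {n : ℕ} {x y : Zn n} : y ∈ nbrs x ↔ x ∈ nbrs y := by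
  have key : ∀ a b : Zn n, b ∈ nbrs a → a ∈ nbrs b := by
    intro a b h
    obtain ⟨i, rfl | rfl⟩ := mem_nbrs.1 h
    · exact mem_nbrs.2 ⟨i, Or.inr (by simp)⟩
    · exact mem_nbrs.2 ⟨i, Or.inl (by simp)⟩
  exact ⟨key x y, key y x⟩

theorem add_ee_mem_nbrs {n : ℕ} (x : Zn n) (i : Fin n) : x + ee i ∈ nbrs x :=
  mem_nbrs.2 ⟨i, Or.inl rfl⟩

theorem nbrs_subset_clos {n : ℕ} {Ω : Finset (Zn n)} {x : Zn n} (hx : x ∈ Ω) :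
    nbrs x ⊆ clos Ω := by
  intro y hy
  by_cases h : y ∈ Ω
  · exact Finset.mem_union_left _ h
  · exact Finset.mem_union_right _
      (Finset.mem_sdiff.2 ⟨Finset.mem_biUnion.2 ⟨x, hx, hy⟩, h⟩)

theorem subset_clos {n : ℕ} (Ω : Finset (Zn n)) : Ω ⊆ clos Ω := Finset.subset_union_left

theorem not_mem_of_mem_bdry {n : ℕ} {Ω : Finset (Zn n)} {x : Zn n} (hx : x ∈ bdry Ω) :
    x ∉ Ω := (Finset.mem_sdiff.1 hx).2

theorem lap_eq {n : ℕ} (u : Zn n → ℝ) (x : Zn n) :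
    lap u x = ∑ y ∈ nbrs x, u y - (nbrs x).card * u x := by
  simp [lap, Finset.sum_sub_distrib]

/-- If `v ≤ u` near `x` with equality at `x`, then `Δv(x) ≤ Δu(x)`. -/
theorem lap_le_lap {n : ℕ} {u v : Zn n → ℝ} {x : Zn n} (hx : v x = u x)
    (h : ∀ y ∈ nbrs x, v y ≤ u y) : lap v x ≤ lap u x :=
  Finset.sum_le_sum fun y hy => by rw [hx]; linarith [h y hy]

/-- Nonpositive subsolutions of the boundary value problem, extended by zero off `Ω`. -/
def IsSub {n : ℕ} (lam : ℝ) (g : Zn n → ℝ) (Ω : Finset (Zn n)) (v : Zn n → ℝ) : Prop :=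
  (∀ x, v x ≤ 0) ∧ (∀ x, x ∉ Ω → v x = 0) ∧
    ∀ x ∈ Ω, lam * (Real.exp (v x) * (Real.exp (v x) - 1)) + g x ≤ lap v x

theorem isSub_cutoff {n : ℕ} {lam : ℝ} {g : Zn n → ℝ} {Ω : Finset (Zn n)} {v : Zn n → ℝ}
    (hv : ∀ x ∈ clos Ω, v x ≤ 0)
    (hsub : ∀ x ∈ Ω, lam * (Real.exp (v x) * (Real.exp (v x) - 1)) + g x ≤ lap v x) :
    IsSub lam g Ω (fun x => if x ∈ Ω then v x else 0) := by
  refine ⟨fun x => ?_, fun x hx => if_neg hx, fun x hx => ?_⟩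
  · dsimp only
    split_ifs with h
    · exact hv x (subset_clos Ω h)
    · exact le_rfl
  · simp only [if_pos hx]
    refine (hsub x hx).trans (lap_le_lap (by simp [hx]) fun y hy => ?_)
    split_ifs with h
    · exact le_rfl
    · exact hv y (nbrs_subset_clos hx hy)

theorem exp_mul_exp_sub_one_nonpos {t : ℝ} (ht : t ≤ 0) :
    Real.exp t * (Real.exp t - 1) ≤ 0 :=
  mul_nonpos_of_nonneg_of_nonpos (Real.exp_pos t).le (by linarith [Real.exp_le_one_iff.2 ht])

theorem lap_coord_sq {n : ℕ} (i : Fin n) (A R : ℝ) (x : Zn n) :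
    lap (fun y => A * ((y i : ℝ) ^ 2 - R)) x = 2 * A := by
  have hne : x + ee i ≠ x - ee i := by
    intro h
    have := congrFun h i
    simp [ee] at this
    omega
  have hsub : ({x + ee i, x - ee i} : Finset (Zn n)) ⊆ nbrs x := by
    intro y hy
    rw [Finset.mem_insert, Finset.mem_singleton] at hy
    exact mem_nbrs.2 ⟨i, hy⟩
  unfold lap
  rw [← Finset.sum_subset hsub, Finset.sum_pair hne]
  · simp [ee]; ring
  · intro y hy hy'
    obtain ⟨j, hj⟩ := mem_nbrs.1 hy
    have hij : i ≠ j := by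
      rintro rfl
      exact hy' (by simpa using hj)
    have : y i = x i := by
      rcases hj with rfl | rfl <;> simp [ee, hij]
    simp [this]

theorem exists_isSub {n : ℕ} (i : Fin n) {lam : ℝ} (hlam : 0 < lam) {g : Zn n → ℝ}
    (hg : ∀ x, 0 ≤ g x) (Ω : Finset (Zn n)) : ∃ v, IsSub lam g Ω v := by
  set A : ℝ := ∑ x ∈ Ω, g x
  set R : ℝ := ∑ x ∈ clos Ω, (x i : ℝ) ^ 2
  have hA : 0 ≤ A := Finset.sum_nonneg fun x _ => hg x
  have hneg : ∀ x ∈ clos Ω, A * ((x i : ℝ) ^ 2 - R) ≤ 0 := fun x hx =>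
    mul_nonpos_of_nonneg_of_nonpos hA (sub_nonpos.2
      (Finset.single_le_sum (f := fun x : Zn n => (x i : ℝ) ^ 2) (fun _ _ => sq_nonneg _) hx))
  refine ⟨_, isSub_cutoff (v := fun x => A * ((x i : ℝ) ^ 2 - R)) hneg fun x hx => ?_⟩
  rw [lap_coord_sq]
  have h1 := exp_mul_exp_sub_one_nonpos (hneg x (subset_clos Ω hx))
  have h2 : g x ≤ A := Finset.single_le_sum (fun x _ => hg x) hx
  nlinarith

/-- Perron's method: the pointwise supremum of all subsolutions is a subsolution. -/
theorem exists_greatest_isSub {n : ℕ} (i : Fin n) {lam : ℝ} (hlam : 0 < lam) {g : Zn n → ℝ}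
    (hg : ∀ x, 0 ≤ g x) (Ω : Finset (Zn n)) :
    ∃ W, IsSub lam g Ω W ∧ ∀ v, IsSub lam g Ω v → ∀ x, v x ≤ W x := by
  obtain ⟨v₀, hv₀⟩ := exists_isSub i hlam hg Ω
  let V : Zn n → Set ℝ := fun x => (fun v : Zn n → ℝ => v x) '' {v | IsSub lam g Ω v}
  have hne : ∀ x, (V x).Nonempty := fun x => ⟨_, v₀, hv₀, rfl⟩
  have hbdd : ∀ x, BddAbove (V x) := by
    refine fun x => ⟨0, ?_⟩
    rintro _ ⟨v, hv, rfl⟩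
    exact hv.1 x
  have hle : ∀ v, IsSub lam g Ω v → ∀ x, v x ≤ sSup (V x) := fun v hv x =>
    le_csSup (hbdd x) ⟨v, hv, rfl⟩
  refine ⟨fun x => sSup (V x), ⟨fun x => csSup_le (hne x) ?_, fun x hx => ?_, fun x hx => ?_⟩, hle⟩
  · rintro _ ⟨v, hv, rfl⟩
    exact hv.1 x
  · refine le_antisymm (csSup_le (hne x) ?_) ?_
    · rintro _ ⟨v, hv, rfl⟩
      exact hv.1 x
    · rw [← hv₀.2.1 x hx]
      exact hle v₀ hv₀ x
  · have hclosed : IsClosed {s : ℝ | lam * (Real.exp s * (Real.exp s - 1)) + g x +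
        (nbrs x).card * s ≤ ∑ y ∈ nbrs x, sSup (V y)} :=
      isClosed_le (by fun_prop) continuous_const
    have hmem := closure_minimal (s := V x) ?_ hclosed (csSup_mem_closure (hne x) (hbdd x))
    · rw [lap_eq]
      simp only [Set.mem_ofPred_eq] at hmem
      linarith
    · rintro _ ⟨v, hv, rfl⟩
      have h := hv.2.2 x hx
      rw [lap_eq] at h
      have h2 : ∑ y ∈ nbrs x, v y ≤ ∑ y ∈ nbrs x, sSup (V y) :=
        Finset.sum_le_sum fun y _ => hle v hv y
      simp only [Set.mem_ofPred_eq]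
      linarith

/-- Maximum principle: solutions that are nonpositive on the boundary are nonpositive. -/
theorem nonpos_of_isSolution {n : ℕ} {lam : ℝ} (hlam : 0 < lam) {g : Zn n → ℝ}
    (hg : ∀ x, 0 ≤ g x) {Ω : Finset (Zn n)} {v : Zn n → ℝ}
    (hv : ∀ x ∈ Ω, lap v x = lam * (Real.exp (v x) * (Real.exp (v x) - 1)) + g x)
    (hb : ∀ x ∈ bdry Ω, v x ≤ 0) : ∀ x ∈ clos Ω, v x ≤ 0 := by
  by_contra! hcon
  obtain ⟨x₀, hx₀, hpos⟩ := hcon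
  obtain ⟨z, hz, hmax⟩ := Finset.exists_max_image (clos Ω) v ⟨x₀, hx₀⟩
  have hzpos : 0 < v z := hpos.trans_le (hmax x₀ hx₀)
  have hzΩ : z ∈ Ω := by
    rcases Finset.mem_union.1 hz with h | h
    · exact h
    · exact absurd (hb z h) hzpos.not_ge
  have h1 : lap v z ≤ 0 := Finset.sum_nonpos fun y hy =>
    sub_nonpos.2 (hmax y (nbrs_subset_clos hzΩ hy))
  have h2 : 0 < Real.exp (v z) * (Real.exp (v z) - 1) :=
    mul_pos (Real.exp_pos _) (sub_pos.2 (Real.one_lt_exp_iff.2 hzpos))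
  have h3 := hv z hzΩ
  have h4 := mul_pos hlam h2
  linarith [hg z]

/-- The Dirichlet energy on the edges inside `T`, each edge being counted in both directions. -/
noncomputable def dirichlet {n : ℕ} (T : Finset (Zn n)) (u : Zn n → ℝ) : ℝ :=
  ∑ x ∈ T, ∑ y ∈ T, if y ∈ nbrs x then (u y - u x) ^ 2 else 0

/-- The action functional whose critical points are the solutions of the equation. -/
noncomputable def action {n : ℕ} (lam : ℝ) (g : Zn n → ℝ) (Ω T : Finset (Zn n))
    (u : Zn n → ℝ) : ℝ :=
  1 / 4 * dirichlet T u + ∑ x ∈ Ω, (lam / 2 * (Real.exp (u x) - 1) ^ 2 + g x * u x)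

theorem continuous_action {n : ℕ} (lam : ℝ) (g : Zn n → ℝ) (Ω T : Finset (Zn n)) :
    Continuous (action lam g Ω T) := by
  unfold action dirichlet
  refine (continuous_const.mul (continuous_finsetSum _ fun x _ => continuous_finsetSum _
    fun y _ => ?_)).add (by fun_prop)
  split_ifs
  · fun_prop
  · exact continuous_const

theorem sum_grad_mul_grad {n : ℕ} (T : Finset (Zn n)) (u d : Zn n → ℝ) :
    ∑ x ∈ T, ∑ y ∈ T, (if y ∈ nbrs x then (u y - u x) * (d y - d x) else 0) =
      -2 * ∑ x ∈ T, d x * ∑ y ∈ T, if y ∈ nbrs x then u y - u x else 0 := by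
  have h1 : ∑ x ∈ T, ∑ y ∈ T, (if y ∈ nbrs x then (u y - u x) * d y else 0) =
      ∑ x ∈ T, ∑ y ∈ T, -(if y ∈ nbrs x then (u y - u x) * d x else 0) := by
    rw [Finset.sum_comm]
    refine Finset.sum_congr rfl fun x _ => Finset.sum_congr rfl fun y _ => ?_
    simp only [mem_nbrs_comm (x := y) (y := x)]
    split_ifs <;> ring
  have h2 : ∑ x ∈ T, ∑ y ∈ T, (if y ∈ nbrs x then (u y - u x) * (d y - d x) else 0) =
      ∑ x ∈ T, ∑ y ∈ T, (if y ∈ nbrs x then (u y - u x) * d y else 0) +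
      ∑ x ∈ T, ∑ y ∈ T, -(if y ∈ nbrs x then (u y - u x) * d x else 0) := by
    simp only [← Finset.sum_add_distrib]
    refine Finset.sum_congr rfl fun x _ => Finset.sum_congr rfl fun y _ => ?_
    split_ifs <;> ring
  rw [h2, h1, ← two_mul, Finset.mul_sum, Finset.mul_sum]
  refine Finset.sum_congr rfl fun x _ => ?_
  rw [Finset.mul_sum, Finset.mul_sum, Finset.mul_sum]
  refine Finset.sum_congr rfl fun y _ => ?_
  split_ifs <;> ring

theorem hasDerivAt_action {n : ℕ} (lam : ℝ) (g : Zn n → ℝ) {Ω T : Finset (Zn n)}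
    (hT : clos Ω ⊆ T) (u : Zn n → ℝ) {z : Zn n} (hz : z ∈ Ω) :
    HasDerivAt (fun t : ℝ => action lam g Ω T (fun x => u x + t * if x = z then 1 else 0))
      (lam * (Real.exp (u z) * (Real.exp (u z) - 1)) + g z - lap u z) 0 := by
  set d : Zn n → ℝ := fun x => if x = z then 1 else 0 with hd
  have hlin : ∀ x, HasDerivAt (fun t : ℝ => u x + t * d x) (d x) 0 := fun x => by
    simpa using ((hasDerivAt_id (0 : ℝ)).mul_const (d x)).const_add (u x)
  have hE : HasDerivAt (fun t : ℝ => dirichlet T (fun x => u x + t * d x))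
      (∑ x ∈ T, ∑ y ∈ T,
        2 * if y ∈ nbrs x then (u y - u x) * (d y - d x) else 0) 0 := by
    unfold dirichlet
    refine HasDerivAt.fun_sum fun x _ => HasDerivAt.fun_sum fun y _ => ?_
    split_ifs
    · refine (((hlin y).fun_sub (hlin x)).fun_pow 2).congr_deriv ?_
      simp; ring
    · simpa using hasDerivAt_const (0 : ℝ) (0 : ℝ)
  have hP : HasDerivAt (fun t : ℝ => ∑ x ∈ Ω, (lam / 2 * (Real.exp (u x + t * d x) - 1) ^ 2 +
      g x * (u x + t * d x)))
      (∑ x ∈ Ω, d x * (lam * (Real.exp (u x) * (Real.exp (u x) - 1)) + g x)) 0 := by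
    refine HasDerivAt.fun_sum fun x _ => ?_
    refine (((((hlin x).exp.sub_const 1).fun_pow 2).const_mul (lam / 2)).fun_add
      ((hlin x).const_mul (g x))).congr_deriv ?_
    simp; ring
  have key := (hE.const_mul (1 / 4)).add hP
  have hzT : z ∈ T := hT (subset_clos Ω hz)
  have hlap : ∑ y ∈ T, (if y ∈ nbrs z then u y - u z else 0) = lap u z := by
    rw [Finset.sum_ite_mem, Finset.inter_eq_right.2 ((nbrs_subset_clos hz).trans hT)]
    rfl
  refine key.congr_deriv ?_
  simp only [← Finset.mul_sum]
  rw [sum_grad_mul_grad]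
  simp only [hd, ite_mul, one_mul, zero_mul, Finset.sum_ite_eq', hzT, hz, if_true, hlap]
  ring

/-- A minimizer of the action above a subsolution `W` and below `0` solves the equation. -/
theorem isSolution_of_isMinOn {n : ℕ} {lam : ℝ} {g : Zn n → ℝ} (hg : ∀ x, 0 ≤ g x)
    {Ω T : Finset (Zn n)} (hT : clos Ω ⊆ T) {W u : Zn n → ℝ} (hW : IsSub lam g Ω W)
    (hu : u ∈ Set.Icc W 0) (hmin : IsMinOn (action lam g Ω T) (Set.Icc W 0) u) :
    ∀ z ∈ Ω, lap u z = lam * (Real.exp (u z) * (Real.exp (u z) - 1)) + g z := by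
  intro z hz
  have hder := hasDerivAt_action lam g hT u hz
  have hmin' : ∀ t : ℝ, W z ≤ u z + t → u z + t ≤ 0 →
      action lam g Ω T (fun x => u x + 0 * if x = z then 1 else 0) ≤
      action lam g Ω T (fun x => u x + t * if x = z then 1 else 0) := by
    intro t h1 h2
    simp only [zero_mul, add_zero]
    refine hmin ⟨fun x => ?_, fun x => ?_⟩
    · by_cases h : x = z
      · subst h; simpa using h1
      · simpa [h] using hu.1 x
    · by_cases h : x = z
      · subst h; simpa using h2
      · simpa [h] using hu.2 x
  have hupper : u z ≤ 0 := hu.2 z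
  have hlower : W z ≤ u z := hu.1 z
  apply le_antisymm
  · rcases hupper.eq_or_lt with h0 | h0
    · have h1 : lap u z ≤ 0 := Finset.sum_nonpos fun y _ => by
        have : u y ≤ 0 := hu.2 y
        linarith
      rw [h0]
      simp only [Real.exp_zero, sub_self, mul_zero, zero_add]
      exact h1.trans (hg z)
    · have := ge_of_tendsto hder.tendsto_slope_zero_right (b := 0) ?_
      · linarith
      · filter_upwards [Ioo_mem_nhdsGT (neg_pos.2 h0)] with t ht
        have := hmin' t (by linarith [ht.1]) (by linarith [ht.2])
        rw [zero_add, smul_eq_mul]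
        exact mul_nonneg (inv_nonneg.2 ht.1.le) (by linarith)
  · rcases hlower.eq_or_lt with h0 | h0
    · rw [← h0]
      exact (hW.2.2 z hz).trans (lap_le_lap h0 fun y _ => hu.1 y)
    · have := le_of_tendsto hder.tendsto_slope_zero_left (b := 0) ?_
      · linarith
      · filter_upwards [Ioo_mem_nhdsLT (sub_neg.2 h0)] with t ht
        have := hmin' t (by linarith [ht.1]) (by linarith [ht.2])
        rw [zero_add, smul_eq_mul]
        exact mul_nonpos_of_nonpos_of_nonneg (inv_nonpos.2 ht.2.le) (by linarith)

theorem action_zero {n : ℕ} (lam : ℝ) (g : Zn n → ℝ) (Ω T : Finset (Zn n)) :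
    action lam g Ω T 0 = 0 := by
  simp [action, dirichlet]

/-- The greatest subsolution is a solution, and its action is nonpositive. -/
theorem isSolution_of_greatest {n : ℕ} {lam : ℝ} {g : Zn n → ℝ} (hg : ∀ x, 0 ≤ g x)
    {Ω T : Finset (Zn n)} (hT : clos Ω ⊆ T) {W : Zn n → ℝ} (hW : IsSub lam g Ω W)
    (hmax : ∀ v, IsSub lam g Ω v → ∀ x, v x ≤ W x) :
    (∀ z ∈ Ω, lap W z = lam * (Real.exp (W z) * (Real.exp (W z) - 1)) + g z) ∧
      action lam g Ω T W ≤ 0 := by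
  have h0 : (0 : Zn n → ℝ) ∈ Set.Icc W 0 := ⟨hW.1, le_rfl⟩
  obtain ⟨u, hu, hmin⟩ := (isCompact_Icc (a := W) (b := 0)).exists_isMinOn ⟨0, h0⟩
    (continuous_action lam g Ω T).continuousOn
  have hsol := isSolution_of_isMinOn hg hT hW hu hmin
  have hsub : IsSub lam g Ω u :=
    ⟨hu.2, fun x hx => le_antisymm (hu.2 x) ((hW.2.1 x hx).symm.le.trans (hu.1 x)),
      fun x hx => (hsol x hx).symm.le⟩
  have huW : u = W := le_antisymm (hmax u hsub) hu.1
  subst huW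
  exact ⟨hsol, (hmin h0).trans_eq (action_zero lam g Ω T)⟩

theorem dirichlet_nonneg {n : ℕ} (T : Finset (Zn n)) (u : Zn n → ℝ) : 0 ≤ dirichlet T u :=
  Finset.sum_nonneg fun _ _ => Finset.sum_nonneg fun _ _ => by
    split_ifs
    · exact sq_nonneg _
    · exact le_rfl

theorem nsmul_ee_apply {n : ℕ} (k : ℕ) (i j : Fin n) :
    (k • (ee i : Zn n)) j = if j = i then (k : ℤ) else 0 := by
  simp [ee]

/-- Along a straight segment of length `L` inside `T`, the increment of `u` is controlled by the
Dirichlet energy. -/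
theorem sq_sub_le_mul_dirichlet {n : ℕ} {T : Finset (Zn n)} (u : Zn n → ℝ) (x : Zn n)
    (i : Fin n) (L : ℕ) (hT : ∀ k ≤ L, x + k • ee i ∈ T) :
    (u (x + L • ee i) - u x) ^ 2 ≤ L * dirichlet T u := by
  have htel : u (x + L • ee i) - u x =
      ∑ k ∈ Finset.range L, (u (x + (k + 1) • ee i) - u (x + k • ee i)) := by
    rw [Finset.sum_range_sub (fun k => u (x + k • ee i))]
    simp
  have hinj : Set.InjOn (fun k : ℕ => x + k • ee i) (Finset.range L) := by
    intro k _ l _ h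
    have := congrFun (add_left_cancel h) i
    simp only [nsmul_ee_apply, if_true] at this
    exact_mod_cast this
  rw [htel]
  refine sq_sum_le_card_mul_sum_sq.trans ?_
  rw [Finset.card_range]
  refine mul_le_mul_of_nonneg_left ?_ (Nat.cast_nonneg L)
  have hnn : ∀ a b : Zn n, 0 ≤ if b ∈ nbrs a then (u b - u a) ^ 2 else 0 := fun a b => by
    split_ifs
    · exact sq_nonneg _
    · exact le_rfl
  calc ∑ k ∈ Finset.range L, (u (x + (k + 1) • ee i) - u (x + k • ee i)) ^ 2
      ≤ ∑ k ∈ Finset.range L, ∑ y ∈ T,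
          if y ∈ nbrs (x + k • ee i) then (u y - u (x + k • ee i)) ^ 2 else 0 := by
        refine Finset.sum_le_sum fun k hk => ?_
        have hmem : x + (k + 1) • ee i ∈ nbrs (x + k • ee i) := by
          rw [succ_nsmul, ← add_assoc]
          exact add_ee_mem_nbrs _ i
        refine le_trans ?_ (Finset.single_le_sum (fun y _ => hnn (x + k • ee i) y)
          (hT (k + 1) (Finset.mem_range.1 hk)))
        rw [if_pos hmem]
    _ = ∑ a ∈ (Finset.range L).image fun k : ℕ => x + k • ee i, ∑ y ∈ T,
          if y ∈ nbrs a then (u y - u a) ^ 2 else 0 := by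
        rw [Finset.sum_image hinj]
    _ ≤ dirichlet T u := by
        refine Finset.sum_le_sum_of_subset_of_nonneg ?_ fun a _ _ =>
          Finset.sum_nonneg fun y _ => hnn a y
        rw [Finset.image_subset_iff]
        exact fun k hk => hT k (Finset.mem_range.1 hk).le

/-- Points of a two-dimensional lattice quadrant based at `p`. -/
def quadrantPoint {n : ℕ} (p : Zn n) (i j : Fin n) (q : ℕ × ℕ) : Zn n :=
  p + q.1 • ee i + q.2 • ee j

theorem quadrantPoint_injective {n : ℕ} (p : Zn n) {i j : Fin n} (hij : i ≠ j) :
    Function.Injective (quadrantPoint p i j) := by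
  rintro ⟨a, b⟩ ⟨a', b'⟩ h
  have hi := congrFun h i
  have hj := congrFun h j
  simp only [quadrantPoint, Pi.add_apply, nsmul_ee_apply, hij, hij.symm, if_true, if_false] at hi hj
  ext <;> simp <;> omega

/-- On the lattice square of side `L` based at `p`, a function of Dirichlet energy at most
`4 * E` drops by at most `m / 2` provided that `64 * (L * E) ≤ m ^ 2`. -/
theorem sub_half_le_of_dirichlet_le {n : ℕ} {T : Finset (Zn n)} {u : Zn n → ℝ} {p : Zn n}
    {i j : Fin n} {L : ℕ} {E m : ℝ}
    (hT : ∀ a ≤ L, ∀ b ≤ L, quadrantPoint p i j (a, b) ∈ T) (hm : 0 ≤ m)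
    (hE : dirichlet T u ≤ 4 * E) (hL : 64 * (L * E) ≤ m ^ 2) {a b : ℕ} (ha : a ≤ L)
    (hb : b ≤ L) : u (quadrantPoint p i j (a, b)) ≤ u p + m / 2 := by
  have hstep : ∀ (x : Zn n) (l : Fin n) (k : ℕ), k ≤ L → (∀ k' ≤ k, x + k' • ee l ∈ T) →
      u (x + k • ee l) - u x ≤ m / 4 := by
    intro x l k hk hkT
    refine le_of_abs_le (abs_le_of_sq_le_sq ?_ (by positivity))
    have h1 := sq_sub_le_mul_dirichlet u x l k hkT
    have h2 : (k : ℝ) * dirichlet T u ≤ L * (4 * E) :=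
      mul_le_mul (by exact_mod_cast hk) hE (dirichlet_nonneg T u) (Nat.cast_nonneg L)
    linarith
  have h1 := hstep p i a ha fun k hk => by
    simpa [quadrantPoint] using hT k (hk.trans ha) 0 (Nat.zero_le L)
  have h2 := hstep (p + a • ee i) j b hb fun k hk => hT a ha k (hk.trans hb)
  simp only [quadrantPoint]
  linarith

/-- Uniform bound on the depth of a nonpositive function `W` of nonpositive action. -/
theorem depth_le {n : ℕ} {i j : Fin n} (hij : i ≠ j) {lam : ℝ} (hlam : 0 < lam)
    {g : Zn n → ℝ} (hg : ∀ x, 0 ≤ g x) {Ω : Finset (Zn n)} {W : Zn n → ℝ}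
    (hW0 : ∀ x, x ∉ Ω → W x = 0) {G m : ℝ} (hG : 0 < G) (hgG : ∑ x ∈ Ω, g x ≤ G)
    (hact : ∀ T, clos Ω ⊆ T → action lam g Ω T W ≤ 0)
    (hm : 2 ≤ m) (hmin : ∀ x, -m ≤ W x) {p : Zn n} (hp : W p = -m) :
    m ≤ 2 * G * (64 * G) ^ 2 / (lam * (1 - Real.exp (-1)) ^ 2) := by
  set L : ℕ := ⌊m / (64 * G)⌋₊
  set Q : Finset (ℕ × ℕ) := Finset.range (L + 1) ×ˢ Finset.range (L + 1)
  set T : Finset (Zn n) := clos Ω ∪ Q.image (quadrantPoint p i j)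
  have hc : 0 < 1 - Real.exp (-1) := sub_pos.2 (Real.exp_lt_one_iff.2 (by norm_num))
  have hQT : ∀ a ≤ L, ∀ b ≤ L, quadrantPoint p i j (a, b) ∈ T := fun a ha b hb =>
    Finset.mem_union_right _ (Finset.mem_image_of_mem _ (Finset.mem_product.2
      ⟨Finset.mem_range.2 (Nat.lt_succ_of_le ha), Finset.mem_range.2 (Nat.lt_succ_of_le hb)⟩))
  have hlow : -(G * m) ≤ ∑ x ∈ Ω, g x * W x := by
    have h1 : ∑ x ∈ Ω, g x * -m ≤ ∑ x ∈ Ω, g x * W x :=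
      Finset.sum_le_sum fun x _ => mul_le_mul_of_nonneg_left (hmin x) (hg x)
    rw [← Finset.sum_mul] at h1
    nlinarith
  have hA := hact T Finset.subset_union_left
  simp only [action, Finset.sum_add_distrib, ← Finset.mul_sum] at hA
  have hpot : 0 ≤ ∑ x ∈ Ω, (Real.exp (W x) - 1) ^ 2 := Finset.sum_nonneg fun _ _ => sq_nonneg _
  have hE : dirichlet T W ≤ 4 * (G * m) := by nlinarith
  have hD := dirichlet_nonneg T W
  have hLm : (L : ℝ) ≤ m / (64 * G) := Nat.floor_le (by positivity)
  have hmL : m / (64 * G) ≤ L + 1 := (Nat.lt_floor_add_one _).le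
  have hL : 64 * (L * (G * m)) ≤ m ^ 2 := by
    rw [le_div_iff₀ (by positivity)] at hLm
    nlinarith
  have hQ : ∀ q ∈ Q, W (quadrantPoint p i j q) ≤ -1 := by
    rintro ⟨a, b⟩ hq
    obtain ⟨ha, hb⟩ := Finset.mem_product.1 hq
    have := sub_half_le_of_dirichlet_le hQT (by linarith) hE hL
      (Nat.lt_succ_iff.1 (Finset.mem_range.1 ha)) (Nat.lt_succ_iff.1 (Finset.mem_range.1 hb))
    linarith
  have hcount : ((L : ℝ) + 1) ^ 2 * (1 - Real.exp (-1)) ^ 2 ≤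
      ∑ x ∈ Ω, (Real.exp (W x) - 1) ^ 2 := by
    have h1 : ∑ x ∈ Q.image (quadrantPoint p i j), (1 - Real.exp (-1)) ^ 2 =
        ((L : ℝ) + 1) ^ 2 * (1 - Real.exp (-1)) ^ 2 := by
      rw [Finset.sum_const, Finset.card_image_of_injective _ (quadrantPoint_injective p hij),
        Finset.card_product, Finset.card_range]
      simp [sq]
    rw [← h1]
    calc _ ≤ ∑ x ∈ Q.image (quadrantPoint p i j), (Real.exp (W x) - 1) ^ 2 := by
          refine Finset.sum_le_sum fun x hx => ?_
          obtain ⟨q, hq, rfl⟩ := Finset.mem_image.1 hx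
          have := Real.exp_le_exp.2 (hQ q hq)
          nlinarith
      _ ≤ _ := by
          refine Finset.sum_le_sum_of_subset_of_nonneg (fun x hx => ?_) fun _ _ _ => sq_nonneg _
          obtain ⟨q, hq, rfl⟩ := Finset.mem_image.1 hx
          by_contra hx'
          linarith [hQ q hq, hW0 _ hx']
  have hsq : (m / (64 * G)) ^ 2 ≤ ((L : ℝ) + 1) ^ 2 := by gcongr
  have hfin : lam / 2 * ((m / (64 * G)) ^ 2 * (1 - Real.exp (-1)) ^ 2) ≤ G * m := by
    calc _ ≤ lam / 2 * (((L : ℝ) + 1) ^ 2 * (1 - Real.exp (-1)) ^ 2) := by gcongr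
      _ ≤ lam / 2 * ∑ x ∈ Ω, (Real.exp (W x) - 1) ^ 2 := by gcongr
      _ ≤ G * m := by linarith
  rw [le_div_iff₀ (by positivity)]
  have hmpos : 0 < m := by linarith
  refine le_of_mul_le_mul_right ?_ hmpos
  have hcancel : (64 * G) ^ 2 * (m / (64 * G)) ^ 2 = m ^ 2 := by
    rw [← mul_pow, mul_div_cancel₀ _ (by positivity)]
  calc m * (lam * (1 - Real.exp (-1)) ^ 2) * m = lam * (1 - Real.exp (-1)) ^ 2 * m ^ 2 := by ring
    _ = 2 * (64 * G) ^ 2 *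
          (lam / 2 * ((m / (64 * G)) ^ 2 * (1 - Real.exp (-1)) ^ 2)) := by rw [← hcancel]; ring
    _ ≤ 2 * (64 * G) ^ 2 * (G * m) := by gcongr
    _ = _ := by ring

theorem sq_le_mul_exp_sub_one_sq {t B : ℝ} (ht : t ≤ 0) (hB : -B ≤ t) :
    t ^ 2 ≤ (1 + B) ^ 2 * (Real.exp t - 1) ^ 2 := by
  have h1 : Real.exp t * (1 - t) ≤ 1 := by
    have h := mul_le_mul_of_nonneg_left (Real.add_one_le_exp (-t)) (Real.exp_pos t).le
    rw [← Real.exp_add, add_neg_cancel, Real.exp_zero] at h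
    linarith
  have h2 : Real.exp t ≤ 1 := Real.exp_le_one_iff.2 ht
  have h3 : -t ≤ (1 + B) * (1 - Real.exp t) := by nlinarith
  calc t ^ 2 = (-t) ^ 2 := by ring
    _ ≤ ((1 + B) * (1 - Real.exp t)) ^ 2 := by gcongr; linarith
    _ = _ := by ring

/-- Uniform `l²` bound for nonpositive functions of nonpositive action. -/
theorem exists_sum_sq_le {n : ℕ} {i j : Fin n} (hij : i ≠ j) {lam : ℝ} (hlam : 0 < lam)
    {G : ℝ} (hG : 0 < G) :
    ∃ C : ℝ, ∀ (g : Zn n → ℝ), (∀ x, 0 ≤ g x) → ∀ (Ω : Finset (Zn n)), ∑ x ∈ Ω, g x ≤ G →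
      ∀ W : Zn n → ℝ, (∀ x, W x ≤ 0) → (∀ x, x ∉ Ω → W x = 0) →
      (∀ T, clos Ω ⊆ T → action lam g Ω T W ≤ 0) → ∑ x ∈ Ω, W x ^ 2 ≤ C := by
  set K : ℝ := 2 * G * (64 * G) ^ 2 / (lam * (1 - Real.exp (-1)) ^ 2)
  set B : ℝ := max 2 K
  refine ⟨(1 + B) ^ 2 * (2 * (G * B) / lam), fun g hg Ω hgG W hW hW0 hact => ?_⟩
  have hB0 : 0 < B := lt_max_of_lt_left two_pos
  have hB : ∀ x, -B ≤ W x := by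
    by_contra! hcon
    obtain ⟨x₀, hx₀⟩ := hcon
    have hmemΩ : ∀ x, W x < 0 → x ∈ Ω := fun x hx => by
      by_contra h
      exact hx.ne (hW0 x h)
    have hx₀Ω := hmemΩ x₀ (by linarith)
    obtain ⟨p, hp, hmin⟩ := Finset.exists_min_image Ω W ⟨x₀, hx₀Ω⟩
    have hpB : W p < -B := (hmin x₀ hx₀Ω).trans_lt hx₀
    have h2 : 2 ≤ B := le_max_left _ _
    have hdepth := depth_le hij hlam hg hW0 hG hgG hact (m := -W p) (p := p) (by linarith)
      (fun x => ?_) (by ring)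
    · have : K ≤ B := le_max_right _ _
      linarith
    · rw [neg_neg]
      by_cases hx : x ∈ Ω
      · exact hmin x hx
      · rw [hW0 x hx]
        exact hW p
  have hlow : -(G * B) ≤ ∑ x ∈ Ω, g x * W x := by
    have h1 : ∑ x ∈ Ω, g x * -B ≤ ∑ x ∈ Ω, g x * W x :=
      Finset.sum_le_sum fun x _ => mul_le_mul_of_nonneg_left (hB x) (hg x)
    rw [← Finset.sum_mul] at h1
    nlinarith
  have hA := hact (clos Ω) subset_rfl
  simp only [action, Finset.sum_add_distrib, ← Finset.mul_sum] at hA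
  have hD := dirichlet_nonneg (clos Ω) W
  have hpot : ∑ x ∈ Ω, (Real.exp (W x) - 1) ^ 2 ≤ 2 * (G * B) / lam := by
    rw [le_div_iff₀ hlam]
    linarith
  calc ∑ x ∈ Ω, W x ^ 2 ≤ ∑ x ∈ Ω, (1 + B) ^ 2 * (Real.exp (W x) - 1) ^ 2 :=
        Finset.sum_le_sum fun x _ => sq_le_mul_exp_sub_one_sq (hW x) (hB x)
    _ = (1 + B) ^ 2 * ∑ x ∈ Ω, (Real.exp (W x) - 1) ^ 2 := by rw [Finset.mul_sum]
    _ ≤ _ := by gcongr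

/-- Uniform `l²` bound for the maximal Dirichlet solutions: the constant `C₀`
depends only on `n`, `λ` and `S = ∑ⱼ nⱼ`, not on `Ω`. -/
theorem stmt14 (n : ℕ) (hn : 2 ≤ n) (lam : ℝ) (hlam : 0 < lam) (S : ℕ) :
    ∃ C₀ : ℝ, 0 < C₀ ∧
      ∀ (M : ℕ), 1 ≤ M → ∀ nn : Fin M → ℕ, (∀ j, 0 < nn j) → (∑ j, nn j) = S →
      ∀ p : Fin M → Zn n, Function.Injective p →
      ∀ g : Zn n → ℝ,
        (∀ x, g x = ∑ j, if x = p j then 4 * Real.pi * (nn j : ℝ) else 0) →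
      ∀ Ω : Finset (Zn n), (∀ j, p j ∈ Ω) →
      ∃ w : Zn n → ℝ,
        (∀ x ∈ Ω, lap w x = lam * (Real.exp (w x) * (Real.exp (w x) - 1)) + g x) ∧
        (∀ x ∈ bdry Ω, w x = 0) ∧
        Real.sqrt (∑ x ∈ Ω, w x ^ 2) ≤ C₀ ∧
        (∀ v : Zn n → ℝ,
          (∀ x ∈ Ω, lap v x = lam * (Real.exp (v x) * (Real.exp (v x) - 1)) + g x) →
          (∀ x ∈ bdry Ω, v x ≤ 0) →
          ∀ x ∈ clos Ω, v x ≤ w x) := by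
  have hij : (⟨0, by omega⟩ : Fin n) ≠ ⟨1, by omega⟩ := by simp
  have hG : 0 < 4 * Real.pi * (S : ℝ) + 1 := by positivity
  obtain ⟨C, hC⟩ := exists_sum_sq_le hij hlam hG
  refine ⟨Real.sqrt C + 1, by positivity, ?_⟩
  intro M _ nn _ hS p _ g hgdef Ω _
  have hterm : ∀ x j, 0 ≤ if x = p j then 4 * Real.pi * (nn j : ℝ) else 0 := fun x j => by
    split_ifs <;> positivity
  have hg : ∀ x, 0 ≤ g x := fun x => by
    rw [hgdef]
    exact Finset.sum_nonneg fun j _ => hterm x j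
  have hgG : ∑ x ∈ Ω, g x ≤ 4 * Real.pi * (S : ℝ) + 1 := by
    calc ∑ x ∈ Ω, g x = ∑ j, ∑ x ∈ Ω, if x = p j then 4 * Real.pi * (nn j : ℝ) else 0 := by
          simp only [hgdef]
          exact Finset.sum_comm
      _ ≤ ∑ j, 4 * Real.pi * (nn j : ℝ) := by
          refine Finset.sum_le_sum fun j _ => ?_
          rw [Finset.sum_ite_eq']
          split_ifs
          · exact le_rfl
          · positivity
      _ ≤ 4 * Real.pi * (S : ℝ) + 1 := by
          rw [← Finset.mul_sum, ← hS, Nat.cast_sum]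
          linarith
  obtain ⟨W, hW, hmax⟩ := exists_greatest_isSub ⟨0, by omega⟩ hlam hg Ω
  refine ⟨W, (isSolution_of_greatest hg subset_rfl hW hmax).1,
    fun x hx => hW.2.1 x (not_mem_of_mem_bdry hx), ?_, fun v hv hvb x hx => ?_⟩
  · have h := hC g hg Ω hgG W hW.1 hW.2.1 fun T hT => (isSolution_of_greatest hg hT hW hmax).2
    exact (Real.sqrt_le_sqrt h).trans (le_add_of_nonneg_right zero_le_one)
  · have hneg := nonpos_of_isSolution hlam hg hv hvb
    by_cases hxΩ : x ∈ Ω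
    · simpa [hxΩ] using hmax _ (isSub_cutoff hneg fun y hy => (hv y hy).symm.le) x
    · rw [hW.2.1 x hxΩ]
      exact hneg x hx
end
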